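/- (Symmetry of the Lie-Newmark method) Let 𝕀 be an invertible 3×3 real matrix, τ a function from 3×3 real matrices to ℝ³, and h ∈ ℝ. Suppose Q₀, Q₁ are 3×3 real matrices and W₀, W₁, M ∈ ℝ³ satisfy the Lie-Newmark step with stepsize h: M = W₀ + (h/2)·𝕀⁻¹((𝕀·W₀) × W₀ + τ(Q₀)), Q₁ = Q₀·cay(h·M), and W₁ = M + (h/2)·𝕀⁻¹((𝕀·W₁) × W₁ + τ(Q₁)). Then the Lie-Newmark step with stepsize −h starting from (Q₁, W₁) produces (Q₀, W₀): with M′ := W₁ + (−h/2)·𝕀⁻¹((𝕀·W₁) × W₁ + τ(Q₁)) one has M′ = M, Q₁·cay(−h·M′) = Q₀, and W₀ = M′ + (−h/2)·𝕀⁻¹((𝕀·W₀) × W₀ + τ(Q₀)). -/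

import Mathlib

open Matrix

/-- The hat map sending `x ∈ ℝ³` to the skew-symmetric matrix `x̂`
with `x̂ · y = x × y`. -/
def hat (x : Fin 3 → ℝ) : Matrix (Fin 3) (Fin 3) ℝ :=
  !![0, -x 2, x 1; x 2, 0, -x 0; -x 1, x 0, 0]

/-- The Euclidean norm on `ℝ³`. -/
noncomputable def enorm3 (x : Fin 3 → ℝ) : ℝ :=
  Real.sqrt (∑ i, x i ^ 2)

/-- The Cayley map `cay(x) = I + (4/(4+‖x‖²))·x̂ + (2/(4+‖x‖²))·x̂²`. -/
noncomputable def cay (x : Fin 3 → ℝ) : Matrix (Fin 3) (Fin 3) ℝ :=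
  1 + (4 / (4 + enorm3 x ^ 2)) • hat x + (2 / (4 + enorm3 x ^ 2)) • (hat x * hat x)

/-- The cross product on `ℝ³`. -/
def cross3 (x y : Fin 3 → ℝ) : Fin 3 → ℝ :=
  ![x 1 * y 2 - x 2 * y 1, x 2 * y 0 - x 0 * y 2, x 0 * y 1 - x 1 * y 0]

theorem enorm3_sq (x : Fin 3 → ℝ) : enorm3 x ^ 2 = x 0 ^ 2 + x 1 ^ 2 + x 2 ^ 2 := by
  rw [enorm3, Real.sq_sqrt (Finset.sum_nonneg fun i _ => sq_nonneg (x i)), Fin.sum_univ_three]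

theorem hat_neg (x : Fin 3 → ℝ) : hat (-x) = -hat x := by
  ext i j
  fin_cases i <;> fin_cases j <;> simp [hat]

theorem enorm3_neg (x : Fin 3 → ℝ) : enorm3 (-x) = enorm3 x := by
  simp [enorm3]

theorem hat_mul_hat_mul_hat (x : Fin 3 → ℝ) :
    hat x * hat x * hat x = -(enorm3 x ^ 2) • hat x := by
  rw [enorm3_sq]
  ext i j
  fin_cases i <;> fin_cases j <;> simp [hat, Matrix.mul_apply, Fin.sum_univ_three] <;> ring

theorem cay_mul_cay_neg (x : Fin 3 → ℝ) : cay x * cay (-x) = 1 := by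
  have hne : 4 + enorm3 x ^ 2 ≠ 0 := by positivity
  simp only [cay, hat_neg, enorm3_neg, mul_add, add_mul, one_mul, mul_one, neg_mul, mul_neg,
    neg_neg, smul_neg, smul_mul_assoc, mul_smul_comm, smul_smul, ← mul_assoc,
    hat_mul_hat_mul_hat]
  match_scalars <;> field_simp <;> ring

/-- Symmetry of the Lie-Newmark method: a Lie-Newmark step of stepsize `h` from
`(Q₀,W₀)` to `(Q₁,W₁)` implies a Lie-Newmark step of stepsize `−h` from `(Q₁,W₁)`
back to `(Q₀,W₀)`, with the same half-step velocity. -/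
theorem lie_newmark_symmetric
    (𝕀 : Matrix (Fin 3) (Fin 3) ℝ) (h𝕀 : IsUnit 𝕀)
    (τ : Matrix (Fin 3) (Fin 3) ℝ → Fin 3 → ℝ) (h : ℝ)
    (Q₀ Q₁ : Matrix (Fin 3) (Fin 3) ℝ) (W₀ W₁ M : Fin 3 → ℝ)
    (hM : M = W₀ + (h / 2) • (𝕀⁻¹ *ᵥ (cross3 (𝕀 *ᵥ W₀) W₀ + τ Q₀)))
    (hQ : Q₁ = Q₀ * cay (h • M))
    (hW : W₁ = M + (h / 2) • (𝕀⁻¹ *ᵥ (cross3 (𝕀 *ᵥ W₁) W₁ + τ Q₁))) :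
    W₁ + (-h / 2) • (𝕀⁻¹ *ᵥ (cross3 (𝕀 *ᵥ W₁) W₁ + τ Q₁)) = M ∧
    Q₁ * cay ((-h) • M) = Q₀ ∧
    W₀ = M + (-h / 2) • (𝕀⁻¹ *ᵥ (cross3 (𝕀 *ᵥ W₀) W₀ + τ Q₀)) := by
  refine ⟨?_, ?_, ?_⟩
  · rw [neg_div, neg_smul, ← sub_eq_add_neg, sub_eq_iff_eq_add]
    exact hW
  · rw [hQ, mul_assoc, neg_smul, cay_mul_cay_neg, mul_one]
  · rw [neg_div, neg_smul, ← sub_eq_add_neg, eq_sub_iff_add_eq]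
    exact hM.symm
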